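/- Theorem 1(b). For every probability measure μ on E, every σ_t > 0, σ_y > 0, and every w ∈ F, define q(·, w) : E → ℝ by q(z, w) := ∫ φ_{σ_t}(z − x) · ψ_{σ_y}(w − A x) ∂μ(x), which is (up to a normalizing constant independent of z) the conditional density p(x_t = z | y = w). Then for every z ∈ E: q(z, w) > 0, z ↦ q(z, w) is differentiable at z, the denoiser D(z, w) is well defined, and D(z, w) = z + σ_t² • (q(z, w))⁻¹ • ∇_z q(z, w); equivalently, D_{θ*}(x_t, y) = x_t + σ_t² ∇ log p(x_t | y), since the normalizing constant does not affect the logarithmic gradient in z. -/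

import Mathlib

open MeasureTheory

/-- Isotropic Gaussian density with standard deviation `σ` on `EuclideanSpace ℝ (Fin n)`. -/
noncomputable def gaussDens (n : ℕ) (σ : ℝ) (u : EuclideanSpace ℝ (Fin n)) : ℝ :=
  (2 * Real.pi * σ ^ 2) ^ (-(n : ℝ) / 2) * Real.exp (-‖u‖ ^ 2 / (2 * σ ^ 2))

/-- The (unnormalized) conditional density `q(z, w) ∝ p(x_t = z | y = w)`. -/
noncomputable def condDens (n m : ℕ) (σt σy : ℝ)
    (A : EuclideanSpace ℝ (Fin n) →L[ℝ] EuclideanSpace ℝ (Fin m))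
    (μ : Measure (EuclideanSpace ℝ (Fin n)))
    (z : EuclideanSpace ℝ (Fin n)) (w : EuclideanSpace ℝ (Fin m)) : ℝ :=
  ∫ x, gaussDens n σt (z - x) * gaussDens m σy (w - A x) ∂μ

/-- The conditional MMSE denoiser `D(z, w) = E[x ∣ x_t = z, y = w]`. -/
noncomputable def denoiser (n m : ℕ) (σt σy : ℝ)
    (A : EuclideanSpace ℝ (Fin n) →L[ℝ] EuclideanSpace ℝ (Fin m))
    (μ : Measure (EuclideanSpace ℝ (Fin n)))
    (z : EuclideanSpace ℝ (Fin n)) (w : EuclideanSpace ℝ (Fin m)) :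
    EuclideanSpace ℝ (Fin n) :=
  (condDens n m σt σy A μ z w)⁻¹
    • ∫ x, (gaussDens n σt (z - x) * gaussDens m σy (w - A x)) • x ∂μ

theorem gaussDens_pos_aux (n : ℕ) (σ : ℝ) (hσ : 0 < σ) (u : EuclideanSpace ℝ (Fin n)) :
    0 < gaussDens n σ u := by
  unfold gaussDens
  have := Real.pi_pos
  positivity

theorem gaussDens_le_aux (n : ℕ) (σ : ℝ) (hσ : 0 < σ) (u : EuclideanSpace ℝ (Fin n)) :
    gaussDens n σ u ≤ (2 * Real.pi * σ ^ 2) ^ (-(n : ℝ) / 2) := by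
  unfold gaussDens
  have := Real.pi_pos
  apply mul_le_of_le_one_right (by positivity)
  apply Real.exp_le_one_iff.mpr
  rw [neg_div]
  have : 0 ≤ ‖u‖ ^ 2 / (2 * σ ^ 2) := by positivity
  linarith

theorem gaussDens_mul_norm_le_aux (n : ℕ) (σ : ℝ) (hσ : 0 < σ)
    (u : EuclideanSpace ℝ (Fin n)) :
    gaussDens n σ u * ‖u‖ ≤ (2 * Real.pi * σ ^ 2) ^ (-(n : ℝ) / 2) * σ := by
  unfold gaussDens
  have := Real.pi_pos
  rw [mul_assoc]
  apply mul_le_mul_of_nonneg_left _ (by positivity)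
  rw [neg_div, Real.exp_neg, inv_mul_le_iff₀ (Real.exp_pos _)]
  have h1 := Real.add_one_le_exp (‖u‖ ^ 2 / (2 * σ ^ 2))
  have h2 : ‖u‖ ≤ (‖u‖ ^ 2 / (2 * σ ^ 2) + 1) * σ := by
    have : (‖u‖ ^ 2 / (2 * σ ^ 2) + 1) * σ = (‖u‖ ^ 2 + 2 * σ ^ 2) / (2 * σ) := by
      field_simp
    rw [this, le_div_iff₀ (by positivity)]
    nlinarith [sq_nonneg (‖u‖ - σ), sq_nonneg σ]
  exact h2.trans (mul_le_mul_of_nonneg_right h1 hσ.le)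

theorem gaussDens_continuous_aux (n : ℕ) (σ : ℝ) : Continuous (gaussDens n σ) := by
  unfold gaussDens
  fun_prop

theorem gaussDens_hasGradientAt_aux (n : ℕ) (σ : ℝ) (hσ : 0 < σ)
    (x z : EuclideanSpace ℝ (Fin n)) (c : ℝ) :
    HasFDerivAt (fun z => gaussDens n σ (z - x) * c)
      (InnerProductSpace.toDual ℝ (EuclideanSpace ℝ (Fin n))
        ((-(gaussDens n σ (z - x) * c) / σ ^ 2) • (z - x))) z := by
  have h0 : HasFDerivAt (fun z : EuclideanSpace ℝ (Fin n) => z - x)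
      (ContinuousLinearMap.id ℝ _) z := (hasFDerivAt_id z).sub_const x
  have h1 := ((((h0.norm_sq).neg.mul_const (2 * σ ^ 2)⁻¹).exp.const_mul
    ((2 * Real.pi * σ ^ 2) ^ (-(n : ℝ) / 2))).mul_const c)
  unfold gaussDens
  simp only [div_eq_mul_inv] at *
  refine h1.congr_fderiv ?_
  ext v
  simp
  field_simp

/-- Theorem 1(b): `D_{θ*}(x_t, y) = x_t + σ_t² ∇ log p(x_t | y)`. -/
theorem denoiser_posterior_score (n m : ℕ) (hn : 0 < n) (hm : 0 < m)
    (A : EuclideanSpace ℝ (Fin n) →L[ℝ] EuclideanSpace ℝ (Fin m))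
    (μ : Measure (EuclideanSpace ℝ (Fin n))) [IsProbabilityMeasure μ]
    (σt σy : ℝ) (hσt : 0 < σt) (hσy : 0 < σy)
    (w : EuclideanSpace ℝ (Fin m)) (z : EuclideanSpace ℝ (Fin n)) :
    0 < condDens n m σt σy A μ z w ∧
    DifferentiableAt ℝ (fun z' => condDens n m σt σy A μ z' w) z ∧
    Integrable (fun x => (gaussDens n σt (z - x) * gaussDens m σy (w - A x)) • x) μ ∧
    denoiser n m σt σy A μ z w
      = z + σt ^ 2 • ((condDens n m σt σy A μ z w)⁻¹
          • gradient (fun z' => condDens n m σt σy A μ z' w) z) ∧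
    denoiser n m σt σy A μ z w
      = z + σt ^ 2 • gradient (fun z' => Real.log (condDens n m σt σy A μ z' w)) z := by
  have hg : ∀ x, 0 < gaussDens m σy (w - A x) := fun x => gaussDens_pos_aux m σy hσy _
  have hf : ∀ z x, 0 < gaussDens n σt (z - x) := fun z x => gaussDens_pos_aux n σt hσt _
  have hcn := gaussDens_continuous_aux n σt
  have hcm := gaussDens_continuous_aux m σy
  set C : ℝ := (2 * Real.pi * σt ^ 2) ^ (-(n : ℝ) / 2) with hC
  set C' : ℝ := (2 * Real.pi * σy ^ 2) ^ (-(m : ℝ) / 2) with hC'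
  have hCpos : 0 ≤ C := by have := Real.pi_pos; positivity
  have hK : ∀ z, Integrable
      (fun x => gaussDens n σt (z - x) * gaussDens m σy (w - A x)) μ := by
    intro z
    refine Integrable.of_bound (C := C * C')
      (Continuous.aestronglyMeasurable (by fun_prop)) (.of_forall fun x => ?_)
    rw [Real.norm_of_nonneg (mul_pos (hf z x) (hg x)).le]
    exact mul_le_mul (gaussDens_le_aux n σt hσt _) (gaussDens_le_aux m σy hσy _)
      (hg x).le hCpos
  have hKb : ∀ z x, ‖(gaussDens n σt (z - x) * gaussDens m σy (w - A x)) • (z - x)‖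
      ≤ C * σt * C' := by
    intro z x
    rw [norm_smul, Real.norm_of_nonneg (mul_pos (hf z x) (hg x)).le, mul_right_comm]
    exact mul_le_mul (gaussDens_mul_norm_le_aux n σt hσt _) (gaussDens_le_aux m σy hσy _)
      (hg x).le (by positivity)
  have hKi : ∀ z, Integrable
      (fun x => (gaussDens n σt (z - x) * gaussDens m σy (w - A x)) • (z - x)) μ :=
    fun z => Integrable.of_bound (C := C * σt * C')
      (Continuous.aestronglyMeasurable (by fun_prop)) (.of_forall (hKb z))
  have hpos : 0 < condDens n m σt σy A μ z w := by
    unfold condDens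
    rw [integral_pos_iff_support_of_nonneg (fun x => (mul_pos (hf z x) (hg x)).le) (hK z)]
    have : Function.support
        (fun x => gaussDens n σt (z - x) * gaussDens m σy (w - A x)) = Set.univ := by
      ext x
      simpa using ⟨(hf z x).ne', (hg x).ne'⟩
    rw [this]
    simp
  have hxi : Integrable
      (fun x => (gaussDens n σt (z - x) * gaussDens m σy (w - A x)) • x) μ := by
    have := ((hK z).smul_const z).sub (hKi z)
    refine this.congr (.of_forall fun x => ?_)
    simp [smul_sub]
  set L := (InnerProductSpace.toDual ℝ (EuclideanSpace ℝ (Fin n))) with hL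
  let G : EuclideanSpace ℝ (Fin n) → EuclideanSpace ℝ (Fin n) → EuclideanSpace ℝ (Fin n) :=
    fun z x => (-(gaussDens n σt (z - x) * gaussDens m σy (w - A x)) / σt ^ 2) • (z - x)
  have hGeq : ∀ z x, G z x = (-(σt ^ 2)⁻¹) •
      ((gaussDens n σt (z - x) * gaussDens m σy (w - A x)) • (z - x)) := by
    intro z x
    simp only [G, smul_smul]
    congr 1
    ring
  have hGi : Integrable (G z) μ :=
    ((hKi z).smul (-(σt ^ 2)⁻¹)).congr (.of_forall fun x => (hGeq z x).symm)
  have hGc : Continuous (G z) := by fun_prop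
  have hD : HasFDerivAt (fun z' => condDens n m σt σy A μ z' w)
      (∫ x, L (G z x) ∂μ) z := by
    unfold condDens
    refine hasFDerivAt_integral_of_dominated_of_fderiv_le (s := Set.univ)
      (F' := fun z x => L (G z x))
      (bound := fun _ => (σt ^ 2)⁻¹ * (C * σt * C')) Filter.univ_mem
      (.of_forall fun z' => (hK z').aestronglyMeasurable) (hK z)
      (L.continuous.comp hGc).aestronglyMeasurable
      (.of_forall fun x z' _ => ?_) (integrable_const _)
      (.of_forall fun x z' _ => gaussDens_hasGradientAt_aux n σt hσt x z' _)
    rw [LinearIsometryEquiv.norm_map, hGeq, norm_smul, norm_neg,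
      Real.norm_of_nonneg (by positivity)]
    exact mul_le_mul_of_nonneg_left (hKb z' x) (by positivity)
  have hLi : ∫ x, L (G z x) ∂μ = L (∫ x, G z x ∂μ) :=
    L.toContinuousLinearEquiv.toContinuousLinearMap.integral_comp_comm hGi
  rw [hLi] at hD
  have hgrad : HasGradientAt (fun z' => condDens n m σt σy A μ z' w) (∫ x, G z x ∂μ) z := hD
  have hGint : ∫ x, G z x ∂μ = (-(σt ^ 2)⁻¹) • (condDens n m σt σy A μ z w • z -
      ∫ x, (gaussDens n σt (z - x) * gaussDens m σy (w - A x)) • x ∂μ) := by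
    simp only [hGeq]
    rw [integral_smul]
    simp only [smul_sub (_ * _)]
    rw [integral_sub ((hK z).smul_const z) hxi, integral_smul_const]
    rfl
  have hmain : denoiser n m σt σy A μ z w
      = z + σt ^ 2 • ((condDens n m σt σy A μ z w)⁻¹ • ∫ x, G z x ∂μ) := by
    rw [hGint]
    unfold denoiser
    have h1 := hpos.ne'
    have h2 := hσt.ne'
    generalize (∫ x, (gaussDens n σt (z - x) * gaussDens m σy (w - A x)) • x ∂μ) = I
    match_scalars <;> field_simp <;> simp
  have hlog : HasGradientAt (fun z' => Real.log (condDens n m σt σy A μ z' w))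
      ((condDens n m σt σy A μ z w)⁻¹ • ∫ x, G z x ∂μ) z := by
    rw [hasGradientAt_iff_hasFDerivAt]
    refine (hD.log hpos.ne').congr_fderiv ?_
    simp [hL]
  refine ⟨hpos, hD.differentiableAt, hxi, ?_, ?_⟩
  · rw [hgrad.gradient]; exact hmain
  · rw [hlog.gradient]; exact hmain
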